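/- For all labelled graphs G₁ and G₂ (with the binary label cost), there exists a closest subgraph S to G₁ in G₂, i.e. a subgraph S ⊆ G₂ with SED(G₁, G₂) = GED(G₁, S), such that, ignoring node and edge labels, S is isomorphic to a subgraph of G₁. -/

import Mathlib

open scoped BigOperators

/-- A labelled undirected graph: a finite set of nodes (drawn from the universe `ℕ`),
a finite set of undirected edges on these nodes, and labels in `α` on nodes and edges.
`ε` is the special empty label, which no real node or edge carries. -/
structure LGraph (α : Type) (ε : α) where
  V : Finset ℕ
  E : Finset (Sym2 ℕ)
  edge_mem : ∀ e ∈ E, ∀ v ∈ e, v ∈ V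
  Lv : ℕ → α
  Le : Sym2 ℕ → α
  Lv_ne : ∀ v ∈ V, Lv v ≠ ε
  Le_ne : ∀ e ∈ E, Le e ≠ ε

variable {α : Type} {ε : α}

/-- A graph mapping between `G₁` and `G₂`: a bijection between the extended graphs
(obtained by adding dummy ε-labelled nodes and edges) in which no dummy is matched with a
dummy.  It is encoded by the set `dom` of nodes of `G₁` matched to real nodes of `G₂`
together with the (injective) matching function `f`; nodes of `G₁` outside `dom` are
matched with dummy nodes (deleted), nodes of `G₂` outside `f '' dom` are images of dummy
nodes (inserted).  The induced mapping of edges sends `e ∈ E₁` to `Sym2.map f e`, which is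
a real edge of `G₂` precisely when both endpoints are matched and the image is in `E₂`. -/
structure GMap (G₁ G₂ : LGraph α ε) where
  dom : Finset ℕ
  dom_sub : dom ⊆ G₁.V
  f : ℕ → ℕ
  maps_to : ∀ v ∈ dom, f v ∈ G₂.V
  injOn : ∀ v ∈ dom, ∀ w ∈ dom, f v = f w → v = w

-- The edges of `G₁` matched with real edges of `G₂` under the mapping.
open Classical in
noncomputable def GMap.matchedEdges {G₁ G₂ : LGraph α ε} (π : GMap G₁ G₂) :
    Finset (Sym2 ℕ) :=
  G₁.E.filter fun e => (∀ v ∈ e, v ∈ π.dom) ∧ e.map π.f ∈ G₂.E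

-- The cost `GED_π(G₁,G₂)` of a graph mapping `π` under label cost `d`:
-- the sum over all (extended) nodes of `d(L(v), L(π v))` plus the sum over all (extended)
-- edges of `d(L(e), L(π e))`; dummy nodes and edges carry the label `ε`.
open Classical in
noncomputable def GMap.cost (d : α → α → ℝ) {G₁ G₂ : LGraph α ε} (π : GMap G₁ G₂) : ℝ :=
  (∑ v ∈ π.dom, d (G₁.Lv v) (G₂.Lv (π.f v)))
    + (∑ v ∈ G₁.V \ π.dom, d (G₁.Lv v) ε)
    + (∑ w ∈ G₂.V \ π.dom.image π.f, d ε (G₂.Lv w))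
    + (∑ e ∈ π.matchedEdges, d (G₁.Le e) (G₂.Le (e.map π.f)))
    + (∑ e ∈ G₁.E \ π.matchedEdges, d (G₁.Le e) ε)
    + (∑ e ∈ G₂.E \ π.matchedEdges.image (Sym2.map π.f), d ε (G₂.Le e))

/-- Graph edit distance under label cost `d`: the minimum of `GED_π` over all mappings. -/
noncomputable def GED (d : α → α → ℝ) (G₁ G₂ : LGraph α ε) : ℝ :=
  sInf { c | ∃ π : GMap G₁ G₂, c = π.cost d }

/-- `S` is a subgraph of `G`. -/
def IsSubgraph (S G : LGraph α ε) : Prop :=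
  S.V ⊆ G.V ∧ S.E ⊆ G.E ∧ (∀ v ∈ S.V, S.Lv v = G.Lv v) ∧ (∀ e ∈ S.E, S.Le e = G.Le e)

/-- Subgraph edit distance: the minimum of `GED(G₁, S)` over all subgraphs `S ⊆ G₂`. -/
noncomputable def SED (d : α → α → ℝ) (G₁ G₂ : LGraph α ε) : ℝ :=
  sInf { c | ∃ S : LGraph α ε, IsSubgraph S G₂ ∧ c = GED d G₁ S }

-- The binary label cost: `1` on distinct labels, `0` on equal labels.
open Classical in
noncomputable def dBin (α : Type) : α → α → ℝ := fun a b => if a = b then 0 else 1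

-- The modified label cost ignoring insertions.
open Classical in
noncomputable def dHat (ε : α) (d : α → α → ℝ) : α → α → ℝ :=
  fun a b => if a = ε then 0 else d a b

theorem dBin_nat (a b : α) : ∃ n : ℕ, dBin α a b = n := by
  unfold dBin
  split_ifs
  · exact ⟨0, by simp⟩
  · exact ⟨1, by simp⟩

theorem cost_nat {G₁ G₂ : LGraph α ε} (π : GMap G₁ G₂) : ∃ n : ℕ, π.cost (dBin α) = n := by
  choose N hN using (dBin_nat (α := α))
  unfold GMap.cost
  simp only [hN, ← Nat.cast_sum, ← Nat.cast_add]
  exact ⟨_, rfl⟩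

/-- The image of a mapping, as a subgraph of the target. -/
noncomputable def imgGraph {G₁ S : LGraph α ε} (π : GMap G₁ S) : LGraph α ε where
  V := π.dom.image π.f
  E := π.matchedEdges.image (Sym2.map π.f)
  edge_mem := by
    intro e he v hv
    obtain ⟨e', he', rfl⟩ := Finset.mem_image.1 he
    obtain ⟨w, hw, rfl⟩ := Sym2.mem_map.1 hv
    simp only [GMap.matchedEdges, Finset.mem_filter] at he'
    exact Finset.mem_image_of_mem _ (he'.2.1 w hw)
  Lv := S.Lv
  Le := S.Le
  Lv_ne := by
    intro v hv
    obtain ⟨w, hw, rfl⟩ := Finset.mem_image.1 hv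
    exact S.Lv_ne _ (π.maps_to w hw)
  Le_ne := by
    intro e he
    obtain ⟨e', he', rfl⟩ := Finset.mem_image.1 he
    simp only [GMap.matchedEdges, Finset.mem_filter] at he'
    exact S.Le_ne _ he'.2.2

/-- The mapping restricted to its image graph. -/
noncomputable def imgMap {G₁ S : LGraph α ε} (π : GMap G₁ S) : GMap G₁ (imgGraph π) where
  dom := π.dom
  dom_sub := π.dom_sub
  f := π.f
  maps_to := fun _ hv => Finset.mem_image_of_mem _ hv
  injOn := π.injOn

theorem imgMap_matched {G₁ S : LGraph α ε} (π : GMap G₁ S) :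
    (imgMap π).matchedEdges = π.matchedEdges := by
  ext e
  constructor
  · intro h
    have h' := h
    simp only [GMap.matchedEdges, Finset.mem_filter] at h'
    obtain ⟨h1, h2, h3⟩ := h'
    obtain ⟨e', he', h4⟩ := Finset.mem_image.1 h3
    simp only [GMap.matchedEdges, Finset.mem_filter] at he' ⊢
    refine ⟨h1, h2, ?_⟩
    have h5 : Sym2.map π.f e' = Sym2.map π.f e := h4
    rw [← h5]
    exact he'.2.2
  · intro h
    have h' := h
    simp only [GMap.matchedEdges, Finset.mem_filter] at h'
    obtain ⟨h1, h2, h3⟩ := h'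
    have h4 : Sym2.map (imgMap π).f e ∈ (imgGraph π).E := Finset.mem_image_of_mem _ h
    simp only [GMap.matchedEdges, Finset.mem_filter]
    exact ⟨h1, h2, h4⟩

theorem dBin_nonneg (a b : α) : 0 ≤ dBin α a b := by
  unfold dBin; split_ifs <;> norm_num

theorem imgMap_cost {G₁ S : LGraph α ε} (π : GMap G₁ S) :
    (imgMap π).cost (dBin α) ≤ π.cost (dBin α) := by
  unfold GMap.cost
  rw [imgMap_matched]
  gcongr ?_ + ?_ + ?_ + ?_ + ?_ + ?_
  · exact le_rfl
  · exact le_rfl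
  · refine Finset.sum_le_sum_of_subset_of_nonneg ?_ (fun _ _ _ => dBin_nonneg _ _)
    intro w hw
    rw [Finset.mem_sdiff] at hw
    refine absurd ?_ hw.2
    convert hw.1 using 1
    simp only [imgGraph, imgMap]
  · exact le_rfl
  · exact le_rfl
  · refine Finset.sum_le_sum_of_subset_of_nonneg ?_ (fun _ _ _ => dBin_nonneg _ _)
    intro w hw
    rw [Finset.mem_sdiff] at hw
    refine absurd ?_ hw.2
    convert hw.1 using 1
    simp only [imgGraph, imgMap]

theorem imgGraph_sub {G₁ S : LGraph α ε} (π : GMap G₁ S) : IsSubgraph (imgGraph π) S := by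
  refine ⟨?_, ?_, fun _ _ => rfl, fun _ _ => rfl⟩
  · intro v hv
    obtain ⟨w, hw, rfl⟩ := Finset.mem_image.1 hv
    exact π.maps_to w hw
  · intro e he
    obtain ⟨e', he', rfl⟩ := Finset.mem_image.1 he
    simp only [GMap.matchedEdges, Finset.mem_filter] at he'
    exact he'.2.2

theorem isSubgraph_trans {A B C : LGraph α ε} (h : IsSubgraph A B) (k : IsSubgraph B C) :
    IsSubgraph A C :=
  ⟨h.1.trans k.1, h.2.1.trans k.2.1, fun v hv => (h.2.2.1 v hv).trans (k.2.2.1 v (h.1 hv)),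
    fun e he => (h.2.2.2 e he).trans (k.2.2.2 e (h.2.1 he))⟩

/-- The mapping that deletes everything. -/
def emptyMap (G₁ S : LGraph α ε) : GMap G₁ S where
  dom := ∅
  dom_sub := by simp
  f := id
  maps_to := by simp
  injOn := by simp

/-- There exists a closest subgraph `S` to `G₁` in `G₂`
(`S ⊆ G₂` with `SED(G₁,G₂) = GED(G₁,S)`) such that, ignoring node and edge labels,
`S` is isomorphic to a subgraph of `G₁` (i.e. there is an injection of the nodes of `S`
into the nodes of `G₁` carrying edges of `S` to edges of `G₁`). -/
theorem exists_closest_subgraph_unlabelled_sub {α : Type} {ε : α} (G₁ G₂ : LGraph α ε) :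
    ∃ S : LGraph α ε, IsSubgraph S G₂ ∧ SED (dBin α) G₁ G₂ = GED (dBin α) G₁ S ∧
      ∃ g : ℕ → ℕ, Set.InjOn g ↑S.V ∧ (∀ v ∈ S.V, g v ∈ G₁.V) ∧
        (∀ e ∈ S.E, e.map g ∈ G₁.E) := by
  classical
  have hex : ∃ n : ℕ, ∃ S : LGraph α ε, IsSubgraph S G₂ ∧ ∃ π : GMap G₁ S,
      π.cost (dBin α) = n := by
    obtain ⟨n, hn⟩ := cost_nat (emptyMap G₁ G₂)
    exact ⟨n, G₂, ⟨subset_rfl, subset_rfl, fun _ _ => rfl, fun _ _ => rfl⟩, _, hn⟩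
  obtain ⟨S, hS, π, hπ⟩ := Nat.find_spec hex
  have hmin : ∀ T : LGraph α ε, IsSubgraph T G₂ → ∀ ρ : GMap G₁ T,
      π.cost (dBin α) ≤ ρ.cost (dBin α) := by
    intro T hT ρ
    obtain ⟨n, hn⟩ := cost_nat ρ
    rw [hn, hπ]
    exact_mod_cast Nat.find_min' hex ⟨T, hT, ρ, hn⟩
  have hGED : ∀ T : LGraph α ε, IsSubgraph T G₂ → π.cost (dBin α) ≤ GED (dBin α) G₁ T := by
    intro T hT
    refine le_csInf ⟨_, emptyMap G₁ T, rfl⟩ ?_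
    rintro c ⟨ρ, rfl⟩
    exact hmin T hT ρ
  have hS' := isSubgraph_trans (imgGraph_sub π) hS
  have hle : GED (dBin α) G₁ (imgGraph π) ≤ π.cost (dBin α) := by
    refine le_trans ?_ (imgMap_cost π)
    refine csInf_le ⟨π.cost (dBin α), ?_⟩ ⟨imgMap π, rfl⟩
    rintro c ⟨ρ, rfl⟩
    exact hmin _ hS' ρ
  refine ⟨imgGraph π, hS', le_antisymm ?_ ?_, ?_⟩
  · refine csInf_le ⟨π.cost (dBin α), ?_⟩ ⟨imgGraph π, hS', rfl⟩
    rintro c ⟨T, hT, rfl⟩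
    exact hGED T hT
  · refine le_csInf ⟨_, imgGraph π, hS', rfl⟩ ?_
    rintro c ⟨T, hT, rfl⟩
    exact hle.trans (hGED T hT)
  · have hinj : Set.InjOn π.f (π.dom : Set ℕ) := fun v hv w hw h => π.injOn v hv w hw h
    have hg : ∀ v ∈ π.dom, Function.invFunOn π.f (π.dom : Set ℕ) (π.f v) = v :=
      fun v hv => hinj.leftInvOn_invFunOn hv
    refine ⟨Function.invFunOn π.f (π.dom : Set ℕ), ?_, ?_, ?_⟩
    · intro a ha b hb hab
      obtain ⟨v, hv, rfl⟩ := Finset.mem_image.1 (Finset.mem_coe.1 ha)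
      obtain ⟨w, hw, rfl⟩ := Finset.mem_image.1 (Finset.mem_coe.1 hb)
      rw [hg v hv, hg w hw] at hab
      rw [hab]
    · intro a ha
      obtain ⟨v, hv, rfl⟩ := Finset.mem_image.1 ha
      rw [hg v hv]
      exact π.dom_sub hv
    · intro e he
      obtain ⟨e', he', rfl⟩ := Finset.mem_image.1 he
      simp only [GMap.matchedEdges, Finset.mem_filter] at he'
      rw [Sym2.map_map]
      have : Sym2.map (Function.invFunOn π.f (π.dom : Set ℕ) ∘ π.f) e' = Sym2.map id e' :=
        Sym2.map_congr fun v hv => hg v (he'.2.1 v hv)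
      rw [this, Sym2.map_id]
      exact he'.1
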